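/- Let K be a finite simple graph with edge set E and let Λ : E → {±1} be an edge marking. Suppose e = {v, w} ∈ E is an edge with Λ_e = 1, suppose v and w are each incident to at least one edge marked −1, and suppose there exists a vertex u adjacent to both v and w with Λ_{{u,v}} ≠ Λ_{{u,w}}. Then there is no x ∈ R(K, SO(3)) with o_K(x) = Λ; that is, the fiber o_K^{−1}(Λ) is empty. -/

import Mathlib

noncomputable section

/-- `SO(3)`: the space of real `3 × 3` matrices `A` with `A * Aᵀ = 1` and `det A = 1`,
topologized as a subspace of the space of matrices. -/
abbrev SO3 : Type := {A : Matrix (Fin 3) (Fin 3) ℝ // A * A.transpose = 1 ∧ A.det = 1}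

/-- The representation variety `R(K, SO(3))`: the subspace of `SO(3)^V` of tuples whose
entries commute along the edges of `K`. -/
def RepVar {V : Type*} (K : SimpleGraph V) : Set (V → SO3) :=
  {x | ∀ v w : V, K.Adj v w → (x v).1 * (x w).1 = (x w).1 * (x v).1}

/-- The identification `ℝ³ ≅ Im(ℍ)` sending `v` to the purely imaginary quaternion
`v 0 · i + v 1 · j + v 2 · k`. -/
def imQuat (v : Fin 3 → ℝ) : Quaternion ℝ := ⟨0, v 0, v 1, v 2⟩

/-- `QuatLift q x` says that the quaternion `q` is a lift of the rotation matrix `x` under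
the conjugation covering homomorphism `π : S³ → SO(3)`, i.e. conjugation by `q` on the
purely imaginary quaternions agrees with the action of `x` on `ℝ³ ≅ Im(ℍ)`. -/
def QuatLift (q : Quaternion ℝ) (x : Matrix (Fin 3) (Fin 3) ℝ) : Prop :=
  ∀ v : Fin 3 → ℝ, q * imQuat v * q⁻¹ = imQuat (x.mulVec v)

/-- `IsObstruction K x Λ` says that the edge marking `Λ` (with values in `{±1} ≅ ℤˣ`) is the
value `o_K(x)` of the obstruction map at `x`: for each edge `{v, w}` of `K` there are unit
quaternion lifts of `x v` and `x w` whose commutator is `Λ {v, w}`.  (The commutator of lifts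
is independent of the choice of lifts, so this determines `Λ` on the edges of `K`.) -/
def IsObstruction {V : Type*} (K : SimpleGraph V) (x : V → SO3) (Λ : Sym2 V → ℤˣ) : Prop :=
  ∀ v w : V, K.Adj v w → ∃ q p : Quaternion ℝ, ‖q‖ = 1 ∧ ‖p‖ = 1 ∧
    QuatLift q (x v).1 ∧ QuatLift p (x w).1 ∧
    q * p * q⁻¹ * p⁻¹ = ((Λ s(v, w) : ℤ) : Quaternion ℝ)

/-- A quaternion commuting with all purely imaginary quaternions is real. -/
theorem quaternion_eq_coe_re_of_commute_imQuat {r : Quaternion ℝ}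
    (h : ∀ a : Fin 3 → ℝ, r * imQuat a = imQuat a * r) : r = (r.re : Quaternion ℝ) := by
  have hi := h ![1, 0, 0]
  have hj := h ![0, 1, 0]
  rw [Quaternion.ext_iff] at hi hj
  simp only [Quaternion.re_mul, Quaternion.imI_mul, Quaternion.imJ_mul,
    Quaternion.imK_mul] at hi hj
  simp [imQuat] at hi hj
  ext <;> simp <;> linarith

/-- Unit quaternion lifts of a rotation are unique up to sign. -/
theorem QuatLift.eq_or_eq_neg {q p : Quaternion ℝ} {x : Matrix (Fin 3) (Fin 3) ℝ}
    (hq : QuatLift q x) (hp : QuatLift p x) (hq1 : ‖q‖ = 1) (hp1 : ‖p‖ = 1) :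
    p = q ∨ p = -q := by
  have hq0 : q ≠ 0 := norm_ne_zero_iff.1 (by simp [hq1])
  have hp0 : p ≠ 0 := norm_ne_zero_iff.1 (by simp [hp1])
  have hr := quaternion_eq_coe_re_of_commute_imQuat (r := q⁻¹ * p) fun a => by
    have e : p * imQuat a * p⁻¹ = q * imQuat a * q⁻¹ := (hp a).trans (hq a).symm
    have e' : p * imQuat a = q * imQuat a * q⁻¹ * p := by
      rw [← e, inv_mul_cancel_right₀ hp0]
    rw [mul_assoc, e']
    simp only [mul_assoc, inv_mul_cancel_left₀ hq0]
  generalize (q⁻¹ * p).re = t at hr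
  have hpq : p = q * (t : Quaternion ℝ) := by rw [← hr, mul_inv_cancel_left₀ hq0]
  have ht : |t| = 1 := by
    have := congrArg norm hpq
    rwa [norm_mul, hq1, hp1, one_mul, Quaternion.norm_coe, Real.norm_eq_abs, eq_comm] at this
  rcases eq_or_eq_neg_of_abs_eq ht with rfl | rfl <;> simp [hpq]

/-- If unit quaternions anticommute, the first one is purely imaginary. -/
theorem quaternion_re_eq_zero_of_anticommute {q p : Quaternion ℝ} (hp : p ≠ 0)
    (h : q * p = -(p * q)) : q.re = 0 := by
  have hn : Quaternion.normSq p ≠ 0 := Quaternion.normSq_ne_zero.2 hp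
  simp only [Quaternion.ext_iff, Quaternion.re_mul, Quaternion.imI_mul, Quaternion.imJ_mul,
    Quaternion.imK_mul, Quaternion.re_neg, Quaternion.imI_neg, Quaternion.imJ_neg,
    Quaternion.imK_neg] at h
  obtain ⟨h0, h1, h2, h3⟩ := h
  have : q.re * Quaternion.normSq p = 0 := by
    rw [Quaternion.normSq_def']
    linear_combination (p.re * h0 + p.imI * h1 + p.imJ * h2 + p.imK * h3) / 2
  exact (mul_eq_zero.1 this).resolve_right hn

/-- A purely imaginary unit quaternion squares to `-1`. -/
theorem quaternion_mul_self_eq_neg_one {q : Quaternion ℝ} (h : q.re = 0) (h1 : ‖q‖ = 1) :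
    q * q = -1 := by
  have hs : star q = -q := Quaternion.star_eq_neg.2 h
  have := Quaternion.self_mul_star q
  rw [hs, Quaternion.normSq_eq_norm_mul_self, h1] at this
  simpa [neg_eq_iff_eq_neg] using this

/-- The obstruction on an edge can be computed from arbitrary unit lifts. -/
theorem IsObstruction.mul_eq {V : Type*} {K : SimpleGraph V} {x : V → SO3} {Λ : Sym2 V → ℤˣ}
    (hx : IsObstruction K x Λ) {v w : V} (h : K.Adj v w) {q p : Quaternion ℝ}
    (hq1 : ‖q‖ = 1) (hp1 : ‖p‖ = 1) (hq : QuatLift q (x v).1) (hp : QuatLift p (x w).1) :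
    q * p = ((Λ s(v, w) : ℤ) : Quaternion ℝ) * (p * q) := by
  obtain ⟨q', p', hq1', hp1', hq', hp', e⟩ := hx v w h
  have hq0 : q' ≠ 0 := norm_ne_zero_iff.1 (by simp [hq1'])
  have hp0 : p' ≠ 0 := norm_ne_zero_iff.1 (by simp [hp1'])
  have e' : q' * p' = ((Λ s(v, w) : ℤ) : Quaternion ℝ) * (p' * q') := by
    rw [← e, ← mul_assoc, inv_mul_cancel_right₀ hp0, inv_mul_cancel_right₀ hq0]
  rcases hq'.eq_or_eq_neg hq hq1' hq1 with rfl | rfl <;>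
    rcases hp'.eq_or_eq_neg hp hp1' hp1 with rfl | rfl <;> simp [e']

/-- A unit lift of a vertex on an edge marked `-1` is purely imaginary. -/
theorem IsObstruction.re_eq_zero {V : Type*} {K : SimpleGraph V} {x : V → SO3}
    {Λ : Sym2 V → ℤˣ} (hx : IsObstruction K x Λ) {v a : V} (h : K.Adj v a)
    (hΛ : Λ s(v, a) = -1) {q : Quaternion ℝ} (hq1 : ‖q‖ = 1) (hq : QuatLift q (x v).1) :
    q.re = 0 := by
  obtain ⟨-, p, -, hp1, -, hp, -⟩ := hx v a h
  have e := hx.mul_eq h hq1 hp1 hq hp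
  exact quaternion_re_eq_zero_of_anticommute (p := p) (norm_ne_zero_iff.1 (by simp [hp1]))
    (by simpa [hΛ] using e)

theorem fiber_empty_of_inconsistent_marking
    {V : Type} [Fintype V] (K : SimpleGraph V) (Λ : Sym2 V → ℤˣ)
    (v w : V) (hvw : K.Adj v w) (hΛvw : Λ s(v, w) = 1)
    (hv : ∃ a : V, K.Adj v a ∧ Λ s(v, a) = -1)
    (hw : ∃ b : V, K.Adj w b ∧ Λ s(w, b) = -1)
    (hu : ∃ u : V, K.Adj u v ∧ K.Adj u w ∧ Λ s(u, v) ≠ Λ s(u, w)) :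
    ¬ ∃ x : V → SO3, x ∈ RepVar K ∧ IsObstruction K x Λ := by
  rintro ⟨x, -, hx⟩
  obtain ⟨a, hva, hΛa⟩ := hv
  obtain ⟨b, hwb, hΛb⟩ := hw
  obtain ⟨u, huv, huw, hne⟩ := hu
  obtain ⟨q, p, hq1, hp1, hq, hp, -⟩ := hx v w hvw
  obtain ⟨r, -, hr1, -, hr, -, -⟩ := hx u v huv
  have hcomm : Commute q p := by simpa [hΛvw, commute_iff_eq] using hx.mul_eq hvw hq1 hp1 hq hp
  have hsq : q * q = p * p :=
    (quaternion_mul_self_eq_neg_one (hx.re_eq_zero hva hΛa hq1 hq) hq1).trans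
      (quaternion_mul_self_eq_neg_one (hx.re_eq_zero hwb hΛb hp1 hp) hp1).symm
  have hqv := hx.mul_eq huv hr1 hq1 hr hq
  have hpw := hx.mul_eq huw hr1 hp1 hr hp
  have hp0 : p ≠ 0 := norm_ne_zero_iff.1 (by simp [hp1])
  have hr0 : r ≠ 0 := norm_ne_zero_iff.1 (by simp [hr1])
  have key : ((Λ s(u, v) : ℤ) : Quaternion ℝ) * (p * r) = (Λ s(u, w) : ℤ) * (p * r) := by
    rcases hcomm.mul_self_eq_mul_self_iff.1 hsq with rfl | rfl
    · rw [← hqv, ← hpw]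
    · rw [← hpw]
      simpa using hqv.symm
  have hΛ := mul_right_cancel₀ (mul_ne_zero hp0 hr0) key
  have hre := congrArg QuaternionAlgebra.re hΛ
  rw [Quaternion.re_intCast, Quaternion.re_intCast] at hre
  exact hne (Units.ext (Int.cast_injective hre))

end
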